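/- In the tiling inverse semigroup S, the product [t₁,P,t₂][t₁',P',t₂'] of two doubly-pointed pattern classes is nonzero if and only if U(P,t₂) ∩ U(P',t₁') ≠ ∅ in the punctured hull Ω_punc. -/

import Mathlib

/- Shared framework: tilings of ℝⁿ and the tiling inverse semigroup (Kellendonk),
   following Exel–Gonçalves–Starling. -/
open Set
open scoped Classical
noncomputable section

abbrev Rn (n : ℕ) := EuclideanSpace ℝ (Fin n)

/-- A prototile: a subset of ℝⁿ homeomorphic to the closed unit ball, carrying a label,
with the origin (the designated puncture) in its interior. -/
structure ProtoTile (n : ℕ) where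
  carrier : Set (Rn n)
  label : ℕ
  ball_like : Nonempty (carrier ≃ₜ (Metric.closedBall (0 : Rn n) 1 : Set (Rn n)))
  origin_mem : (0 : Rn n) ∈ interior carrier

/-- A tile: a translate `p + x` of a prototile `p`; `puncture` is the translation vector,
i.e. the designated point `x(t)` of the tile. -/
structure Tile (n : ℕ) where
  proto : ProtoTile n
  puncture : Rn n

namespace Tile

def carrier {n : ℕ} (t : Tile n) : Set (Rn n) := (fun y => y + t.puncture) '' t.proto.carrier

def translate {n : ℕ} (t : Tile n) (x : Rn n) : Tile n := ⟨t.proto, t.puncture + x⟩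

end Tile

/-- `T + x`, the translate of a collection of tiles. -/
def translateSet {n : ℕ} (T : Set (Tile n)) (x : Rn n) : Set (Tile n) :=
  (fun t => t.translate x) '' T

/-- A partial tiling: tiles with pairwise disjoint interiors. -/
def IsPartialTiling {n : ℕ} (T : Set (Tile n)) : Prop :=
  T.Pairwise fun t t' => interior t.carrier ∩ interior t'.carrier = ∅

/-- The support of a partial tiling. -/
def tsupport' {n : ℕ} (T : Set (Tile n)) : Set (Rn n) := ⋃ t ∈ T, t.carrier

/-- A tiling: a partial tiling whose support is all of ℝⁿ. -/
def IsTiling {n : ℕ} (T : Set (Tile n)) : Prop := IsPartialTiling T ∧ tsupport' T = univ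

/-- A patch: a finite partial tiling. -/
def IsPatch {n : ℕ} (P : Set (Tile n)) : Prop := IsPartialTiling P ∧ P.Finite

/-- `T(U)`: the tiles of `T` meeting the set `U`. -/
def tilesMeeting {n : ℕ} (T : Set (Tile n)) (U : Set (Rn n)) : Set (Tile n) :=
  {t | t ∈ T ∧ (t.carrier ∩ U).Nonempty}

/-- The tiling metric. -/
def tdist {n : ℕ} (T T' : Set (Tile n)) : ℝ :=
  sInf ({1} ∪ {ε : ℝ | 0 < ε ∧ ∃ x x' : Rn n, ‖x‖ < ε ∧ ‖x'‖ < ε ∧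
    tilesMeeting (translateSet T (-x)) (Metric.ball (0 : Rn n) (1/ε)) =
      tilesMeeting (translateSet T' (-x')) (Metric.ball (0 : Rn n) (1/ε))})

/-- Finite local complexity: for each `r > 0` there are only finitely many patches
`T(B(x,r))` up to translation. -/
def FLC {n : ℕ} (T : Set (Tile n)) : Prop :=
  ∀ r : ℝ, 0 < r → ∃ F : Set (Set (Tile n)), F.Finite ∧
    ∀ x : Rn n, ∃ P ∈ F, ∃ y : Rn n, tilesMeeting T (Metric.ball x r) = translateSet P y

/-- Repetitivity. -/
def Repetitive {n : ℕ} (T : Set (Tile n)) : Prop :=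
  ∀ P ⊆ T, IsPatch P → ∃ R : ℝ, 0 < R ∧ ∀ x : Rn n, ∃ y : Rn n,
    translateSet P y ⊆ tilesMeeting T (Metric.ball x R)

def IsPeriodic {n : ℕ} (T : Set (Tile n)) : Prop :=
  ∃ x : Rn n, x ≠ 0 ∧ translateSet T x = T

/-- The continuous hull `Ω_T`, characterized as the set of all tilings every patch of
which appears as a translate of a patch of `T`. -/
def hull {n : ℕ} (T : Set (Tile n)) : Set (Set (Tile n)) :=
  {T' | IsTiling T' ∧ ∀ P ⊆ T', IsPatch P → ∃ x : Rn n, translateSet P x ⊆ T}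

/-- Strong aperiodicity: the hull contains no periodic tiling. -/
def StronglyAperiodic {n : ℕ} (T : Set (Tile n)) : Prop := ∀ T' ∈ hull T, ¬ IsPeriodic T'

/-- The punctured hull: tilings of the hull with a puncture at the origin. -/
def puncturedHull {n : ℕ} (T : Set (Tile n)) : Set (Set (Tile n)) :=
  {T' | T' ∈ hull T ∧ ∃ t ∈ T', t.puncture = 0}

/-- `U(P,t) = {T' : P - x(t) ⊆ T'}`. -/
def U {n : ℕ} (P : Set (Tile n)) (t : Tile n) : Set (Set (Tile n)) :=
  {T' | translateSet P (-t.puncture) ⊆ T'}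

/-- The (tiling-metric) topology on the punctured hull: generated by the balls of `tdist`. -/
def punctopology {n : ℕ} (T : Set (Tile n)) : TopologicalSpace ↥(puncturedHull T) :=
  TopologicalSpace.generateFrom
    {V | ∃ T₀ ∈ puncturedHull T, ∃ ε : ℝ, 0 < ε ∧
      V = {T' : ↥(puncturedHull T) | tdist (T' : Set (Tile n)) T₀ < ε}}

/-- A representative `(t₁, P, t₂)` of a doubly-pointed pattern class of the tiling `T`:
`P` is a patch occurring in `T` whose support has connected interior, `t₁, t₂ ∈ P`. -/
structure SRep (n : ℕ) (T : Set (Tile n)) where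
  t1 : Tile n
  t2 : Tile n
  P : Set (Tile n)
  mem1 : t1 ∈ P
  mem2 : t2 ∈ P
  patch : IsPatch P
  conn : IsConnected (interior (tsupport' P))
  occurs : ∃ x : Rn n, translateSet P x ⊆ T

namespace SRep

variable {n : ℕ} {T : Set (Tile n)}

/-- The involution `[t₁,P,t₂]* = [t₂,P,t₁]`. -/
def star (s : SRep n T) : SRep n T := ⟨s.t2, s.t1, s.P, s.mem2, s.mem1, s.patch, s.conn, s.occurs⟩

/-- A representative of `s* s = [t₂,P,t₂]`. -/
def srcIdem (s : SRep n T) : SRep n T :=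
  ⟨s.t2, s.t2, s.P, s.mem2, s.mem2, s.patch, s.conn, s.occurs⟩

/-- A representative of `s s* = [t₁,P,t₁]`. -/
def ranIdem (s : SRep n T) : SRep n T :=
  ⟨s.t1, s.t1, s.P, s.mem1, s.mem1, s.patch, s.conn, s.occurs⟩

/-- Two triples represent the same doubly-pointed pattern class. -/
def Equiv' (a b : SRep n T) : Prop :=
  ∃ x : Rn n, a.t1.translate x = b.t1 ∧ a.t2.translate x = b.t2 ∧ translateSet a.P x = b.P

/-- The product `[t₁,P,t₂][t₁',P',t₂']` is nonzero: there are translations making both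
patches of `T` with `t₂ + x = t₁' + x'`. -/
def Compat (a b : SRep n T) : Prop :=
  ∃ x x' : Rn n, translateSet a.P x ⊆ T ∧ translateSet b.P x' ⊆ T ∧
    a.t2.translate x = b.t1.translate x'

/-- `c` represents the (nonzero) product of the classes of `a` and `b`:
`[t₁+x, (P+x) ∪ (P'+x'), t₂'+x']`. -/
def Prod' (a b c : SRep n T) : Prop :=
  ∃ x x' : Rn n, translateSet a.P x ⊆ T ∧ translateSet b.P x' ⊆ T ∧
    a.t2.translate x = b.t1.translate x' ∧
    ∃ y : Rn n, c.t1.translate y = a.t1.translate x ∧ c.t2.translate y = b.t2.translate x' ∧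
      translateSet c.P y = translateSet a.P x ∪ translateSet b.P x'

/-- The natural order on idempotent classes, concretely: `e ≤ f` iff for suitable
representatives `t = t'` and `P' ⊆ P`. -/
def le (e f : SRep n T) : Prop :=
  ∃ x : Rn n, f.t1.translate x = e.t1 ∧ translateSet f.P x ⊆ e.P

end SRep

/-- `g` represents `s* e s`. -/
def Prod3 {n : ℕ} {T : Set (Tile n)} (s e g : SRep n T) : Prop :=
  ∃ a : SRep n T, SRep.Prod' (SRep.star s) e a ∧ SRep.Prod' a s g

/-- A filter in the idempotent semilattice `E` of the tiling inverse semigroup, encoded as a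
translation-saturated set of idempotent representatives: nonempty, upward closed and downward
directed (zero is excluded automatically since only nonzero idempotents have representatives). -/
def IsFilterE {n : ℕ} (T : Set (Tile n)) (ξ : Set (SRep n T)) : Prop :=
  ξ.Nonempty ∧ (∀ e ∈ ξ, e.t1 = e.t2) ∧
  (∀ e ∈ ξ, ∀ f : SRep n T, f.t1 = f.t2 → SRep.le e f → f ∈ ξ) ∧
  (∀ e ∈ ξ, ∀ f ∈ ξ, ∃ g ∈ ξ, SRep.le g e ∧ SRep.le g f)

/-- An ultrafilter: a maximal filter. -/
def IsUltraE {n : ℕ} (T : Set (Tile n)) (ξ : Set (SRep n T)) : Prop :=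
  IsFilterE T ξ ∧ ∀ ζ : Set (SRep n T), IsFilterE T ζ → ξ ⊆ ζ → ζ = ξ

/-- `ξ_{T₀} = {[t,P,t] : t = T₀(0), t ∈ P ⊆ T₀}`: the idempotents whose patch, positioned with
its distinguished tile having puncture at the origin, lies in `T₀`. -/
def xiOf {n : ℕ} (T : Set (Tile n)) (T₀ : Set (Tile n)) : Set (SRep n T) :=
  {e | e.t1 = e.t2 ∧ ∃ x : Rn n, (e.t1.translate x).puncture = 0 ∧
    e.t1.translate x ∈ T₀ ∧ translateSet e.P x ⊆ T₀}

/-- The partial tiling `⋃ {P : [t,P,t] ∈ ξ}` associated to a filter (each patch positioned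
with the puncture of its distinguished tile at the origin). -/
def tilingOf {n : ℕ} {T : Set (Tile n)} (ξ : Set (SRep n T)) : Set (Tile n) :=
  ⋃ e ∈ ξ, translateSet e.P (-(e.t1.puncture))

/-- A character of the idempotent semilattice `E`: nonzero, constant on classes,
multiplicative, and vanishing on zero products. -/
def IsCharE {n : ℕ} (T : Set (Tile n)) (φ : SRep n T → Bool) : Prop :=
  (∃ e, φ e = true) ∧
  (∀ e f : SRep n T, SRep.Equiv' e f → φ e = φ f) ∧
  (∀ e f g : SRep n T, e.t1 = e.t2 → f.t1 = f.t2 → SRep.Prod' e f g → φ g = (φ e && φ f)) ∧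
  (∀ e f : SRep n T, e.t1 = e.t2 → f.t1 = f.t2 → ¬ SRep.Compat e f →
    ¬(φ e = true ∧ φ f = true))

/-- The character `φ_{T₀}` of a tiling `T₀` of the punctured hull. -/
def charOf {n : ℕ} (T : Set (Tile n)) (T₀ : Set (Tile n)) : SRep n T → Bool :=
  fun e => decide (e ∈ xiOf T T₀)

/-- A point `(s, T')` of the set `Y`: `T' ∈ Ω_punc` lies in the domain `U(P,t₂)` of `θ_s`. -/
structure GermPt (n : ℕ) (T : Set (Tile n)) where
  s : SRep n T
  tl : Set (Tile n)
  mem_hull : tl ∈ puncturedHull T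
  mem_dom : tl ∈ U s.P s.t2

/-- The germ relation: `(s,T') ∼ (s'',T'')` iff `T' = T''` and there is an idempotent
`e = [t,P'',t]` with `T' ∈ U(P'',t)` and `s e = s'' e` (as classes). -/
def GermRel {n : ℕ} (T : Set (Tile n)) (p q : GermPt n T) : Prop :=
  p.tl = q.tl ∧ ∃ e : SRep n T, e.t1 = e.t2 ∧ p.tl ∈ U e.P e.t1 ∧
    ∃ g h : SRep n T, SRep.Prod' p.s e g ∧ SRep.Prod' q.s e h ∧ SRep.Equiv' g h

/-- The germ topology on the groupoid of germs: basic open sets `Θ(s,V)` for `V` an open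
subset of `U(P,t₂)`. -/
def germTop {n : ℕ} (T : Set (Tile n)) : TopologicalSpace (Quot (GermRel T)) :=
  TopologicalSpace.generateFrom
    {W | ∃ (s : SRep n T) (V : Set (Set (Tile n))),
      (letI := punctopology T;
        IsOpen {T' : ↥(puncturedHull T) | (T' : Set (Tile n)) ∈ V}) ∧
      V ⊆ U s.P s.t2 ∧
      W = {g | ∃ p : GermPt n T, p.s = s ∧ p.tl ∈ V ∧ Quot.mk (GermRel T) p = g}}

/-- `R_punc`: pairs `(T' + x, T')` of punctured-hull tilings which are translates. -/
def RpuncSet {n : ℕ} (T : Set (Tile n)) : Set (Set (Tile n) × Set (Tile n)) :=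
  {q | q.1 ∈ puncturedHull T ∧ q.2 ∈ puncturedHull T ∧ ∃ x : Rn n, q.1 = translateSet q.2 x}

/-- The topology `R_punc` inherits from `Ω_punc × ℝⁿ`. -/
def rpuncTop {n : ℕ} (T : Set (Tile n)) : TopologicalSpace ↥(RpuncSet T) :=
  letI := punctopology T
  TopologicalSpace.induced
    (fun q : ↥(RpuncSet T) =>
      ((⟨q.val.2, q.property.2.1⟩ : ↥(puncturedHull T)), Classical.choose q.property.2.2))
    inferInstance

theorem aux_carrier_translate {n : ℕ} (t : Tile n) (x : Rn n) :
    (t.translate x).carrier = (Homeomorph.addRight x) '' t.carrier := by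
  simp only [Tile.carrier, Tile.translate, Set.image_image, Homeomorph.coe_addRight, add_assoc]

theorem aux_zero_mem {n : ℕ} (t : Tile n) : t.puncture ∈ interior t.carrier := by
  have h : t.carrier = (Homeomorph.addRight t.puncture) '' t.proto.carrier := rfl
  rw [h, ← Homeomorph.image_interior]
  exact ⟨0, t.proto.origin_mem, by simp⟩

theorem aux_tt {n : ℕ} (t : Tile n) (x y : Rn n) :
    (t.translate x).translate y = t.translate (x + y) := by
  simp [Tile.translate, add_assoc]

theorem aux_tsts {n : ℕ} (P : Set (Tile n)) (x y : Rn n) :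
    translateSet (translateSet P x) y = translateSet P (x + y) := by
  simp only [translateSet, Set.image_image, aux_tt]

theorem aux_ts0 {n : ℕ} (P : Set (Tile n)) : translateSet P 0 = P := by
  simp [translateSet, Tile.translate]

theorem aux_mono {n : ℕ} {P Q : Set (Tile n)} (h : P ⊆ Q) (x : Rn n) :
    translateSet P x ⊆ translateSet Q x := Set.image_mono h

theorem aux_tiling {n : ℕ} {T : Set (Tile n)} (hT : IsTiling T) (x : Rn n) :
    IsTiling (translateSet T x) := by
  refine ⟨?_, ?_⟩
  · rintro _ ⟨s, hs, rfl⟩ _ ⟨t, ht, rfl⟩ hne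
    have hst : s ≠ t := fun h => hne (by rw [h])
    have := hT.1 hs ht hst
    simp only [aux_carrier_translate]
    rw [← Homeomorph.image_interior, ← Homeomorph.image_interior,
      ← Set.image_inter (Homeomorph.injective _), this, Set.image_empty]
  · rw [Set.eq_univ_iff_forall]
    intro y
    have hy : y - x ∈ tsupport' T := by rw [hT.2]; trivial
    simp only [tsupport', Set.mem_iUnion] at hy ⊢
    obtain ⟨t, ht, hy⟩ := hy
    refine ⟨t.translate x, ⟨t, ht, rfl⟩, ?_⟩
    rw [aux_carrier_translate]
    exact ⟨y - x, hy, by simp⟩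

/-- In the tiling inverse semigroup, the product `[t₁,P,t₂][t₁',P',t₂']` is nonzero
iff `U(P,t₂) ∩ U(P',t₁') ≠ ∅` in the punctured hull. -/
theorem product_nonzero_iff {n : ℕ} (T : Set (Tile n)) (hT : IsTiling T)
    (hFLC : FLC T) (hrep : Repetitive T) (hap : StronglyAperiodic T)
    (a b : SRep n T) :
    SRep.Compat a b ↔ (U a.P a.t2 ∩ U b.P b.t1 ∩ puncturedHull T).Nonempty := by
  constructor
  · rintro ⟨x, x', ha, hb, he⟩
    have hp : a.t2.puncture + x = b.t1.puncture + x' := congrArg Tile.puncture he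
    refine ⟨translateSet T (-(a.t2.puncture + x)), ⟨?_, ?_⟩, ⟨aux_tiling hT _, ?_⟩, ?_⟩
    · have := aux_mono ha (-(a.t2.puncture + x))
      rw [aux_tsts] at this
      have e : x + -(a.t2.puncture + x) = -a.t2.puncture := by abel
      rwa [e] at this
    · have := aux_mono hb (-(a.t2.puncture + x))
      rw [aux_tsts] at this
      have e : x' + -(a.t2.puncture + x) = -b.t1.puncture := by rw [hp]; abel
      rwa [e] at this
    · intro P hP _
      refine ⟨a.t2.puncture + x, ?_⟩
      have := aux_mono hP (a.t2.puncture + x)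
      rwa [aux_tsts, neg_add_cancel, aux_ts0] at this
    · exact ⟨_, ⟨a.t2.translate x, ha ⟨_, a.mem2, rfl⟩, rfl⟩, by simp [Tile.translate]⟩
  · rintro ⟨T', ⟨ha, hb⟩, ⟨hT', hpat⟩, -⟩
    have ha' : translateSet a.P (-a.t2.puncture) ⊆ T' := ha
    have hb' : translateSet b.P (-b.t1.puncture) ⊆ T' := hb
    obtain ⟨z, hz⟩ := hpat _ (Set.union_subset ha' hb')
      ⟨hT'.1.mono (Set.union_subset ha' hb'),
        (a.patch.2.image _).union (b.patch.2.image _)⟩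
    have heq : a.t2.translate (-a.t2.puncture) = b.t1.translate (-b.t1.puncture) := by
      by_contra hne
      have h := hT'.1 (ha' ⟨_, a.mem2, rfl⟩) (hb' ⟨_, b.mem1, rfl⟩) hne
      have h1 := aux_zero_mem (a.t2.translate (-a.t2.puncture))
      have h2 := aux_zero_mem (b.t1.translate (-b.t1.puncture))
      have e1 : (a.t2.translate (-a.t2.puncture)).puncture = 0 := add_neg_cancel _
      have e2 : (b.t1.translate (-b.t1.puncture)).puncture = 0 := add_neg_cancel _
      rw [e1] at h1
      rw [e2] at h2
      exact Set.notMem_empty (0 : Rn n) (h.subset ⟨h1, h2⟩)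
    refine ⟨-a.t2.puncture + z, -b.t1.puncture + z, ?_, ?_, ?_⟩
    · rw [← aux_tsts]
      exact (aux_mono Set.subset_union_left z).trans hz
    · rw [← aux_tsts]
      exact (aux_mono Set.subset_union_right z).trans hz
    · rw [← aux_tt, ← aux_tt, heq]
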